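/- arXiv:1609.01133 — 4 statements merged into one kernel-verified Lean document; each statement's English description precedes it below -/
import Mathlib

section
/- For every positive integer k, the numerical semigroup generated by S = {6k+3, 6k+5, 12k+4} is a 3-permutation numerical semigroup. -/
/-- The increasing enumeration of the positive elements of a submonoid `G` of `ℕ`
(0-indexed: `posSeq G 0` is the smallest positive element `g₁` of `G`). -/
noncomputable def posSeq (G : AddSubmonoid ℕ) : ℕ → ℕ :=
  Nat.nth (fun x => x ∈ G ∧ 0 < x)

/-- `G` is an `n`-permutation numerical semigroup: `G` is a cofinite submonoid of `ℕ`,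
it is generated by its `n` smallest positive elements `g₁ < ⋯ < gₙ`, and for every
`k ≥ 0` the tuple `(g_{kn+1} mod n, …, g_{kn+n} mod n)` contains exactly one
representative of each residue class of `ℤ/nℤ`. -/
def IsPermutationSemigroup (n : ℕ) (G : AddSubmonoid ℕ) : Prop :=
  ((G : Set ℕ)ᶜ).Finite ∧
  G = AddSubmonoid.closure (posSeq G '' Set.Iio n) ∧
  ∀ k : ℕ, Function.Bijective (fun j : Fin n => ((posSeq G (k * n + j.val) : ℕ) : ZMod n))

/-- Membership test in block `i` at offset `r`. -/
def MM (k i r : ℕ) : Prop :=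
  (r % 2 = 0 ∧ r ≤ 6 * i) ∨ (r % 2 = 1 ∧ 6 * k + 3 ≤ r ∧ r ≤ 6 * k + 5 + 6 * i) ∨
    (r % 2 = 1 ∧ r + 6 * k + 5 ≤ 6 * i)

/-- Membership test for offsets running over two blocks. -/
def NN (k i r : ℕ) : Prop :=
  (r < 12 * k + 4 ∧ MM k i r) ∨ (12 * k + 4 ≤ r ∧ MM k (i + 1) (r - (12 * k + 4)))

/-- First elements of the triples (before the conductor). -/
def PP (k i r : ℕ) : Prop :=
  (i ≤ 2 * k ∧ r % 6 = 2 ∧ r + 4 ≤ 6 * i) ∨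
  (i < 2 * k ∧ r % 6 = 3 ∧ 6 * k + 3 ≤ r ∧ r ≤ 6 * k + 3 + 6 * i ∧ 6 * i < r) ∨
  (i ≤ 2 * k ∧ r % 6 = 5 ∧ 6 * k + 3 ≤ r ∧ r + 1 ≤ 6 * i) ∨
  (i ≤ 2 * k ∧ r % 6 = 5 ∧ r + 6 * k + 7 ≤ 6 * i) ∨
  (i = 2 * k ∧ r = 12 * k + 3)

/-- `r, a, b` are consecutive with distinct residues and `c` is the next element. -/
def Step (k i r a b c : ℕ) : Prop :=
  r < a ∧ a < b ∧ b < c ∧ c < 2 * (12 * k + 4) ∧ NN k i a ∧ NN k i b ∧ NN k i c ∧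
  (∀ t, r < t → t < c → t ≠ a → t ≠ b → ¬ NN k i t) ∧
  r % 3 ≠ a % 3 ∧ a % 3 ≠ b % 3 ∧ r % 3 ≠ b % 3 ∧
  ((c < 12 * k + 4 ∧ PP k i c) ∨ (12 * k + 4 ≤ c ∧ PP k (i + 1) (c - (12 * k + 4))))

set_option maxHeartbeats 1000000 in
lemma step_exists (k i r : ℕ) (hk : 0 < k) (hr : r < 12 * k + 4) (h : PP k i r)
    (hne : ¬ (i = 2 * k ∧ r = 12 * k + 3)) : ∃ a b c, Step k i r a b c := by
  rcases h with h | h | h | h | h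
  pick_goal 5
  · exact absurd h hne
  all_goals clear hne
  · by_cases h1 : 6 * k + 2 ≤ r
    · refine ⟨r+1, r+2, r+3, ?_⟩
      refine ⟨by omega, by omega, by omega, by omega, ?_, ?_, ?_, ?_, by omega, by omega, by omega, ?_⟩
      on_goal 4 => rintro t t1 t2 t3 t4 (⟨u, v | v | v⟩ | ⟨u, v | v | v⟩) <;> omega
      all_goals first
        | exact Or.inl ⟨by omega, Or.inl (by omega)⟩
        | exact Or.inl ⟨by omega, Or.inr (Or.inl (by omega))⟩
        | exact Or.inl ⟨by omega, Or.inr (Or.inr (by omega))⟩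
        | exact Or.inl ⟨by omega, Or.inr (Or.inr (Or.inl (by omega)))⟩
        | exact Or.inl ⟨by omega, Or.inr (Or.inr (Or.inr (Or.inl (by omega))))⟩
        | exact Or.inl ⟨by omega, Or.inr (Or.inr (Or.inr (Or.inr (by omega))))⟩
        | exact Or.inr ⟨by omega, Or.inl (by omega)⟩
        | exact Or.inr ⟨by omega, Or.inr (Or.inl (by omega))⟩
        | exact Or.inr ⟨by omega, Or.inr (Or.inr (by omega))⟩
        | exact Or.inr ⟨by omega, Or.inr (Or.inr (Or.inl (by omega)))⟩
        | exact Or.inr ⟨by omega, Or.inr (Or.inr (Or.inr (Or.inl (by omega))))⟩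
        | exact Or.inr ⟨by omega, Or.inr (Or.inr (Or.inr (Or.inr (by omega))))⟩
    · by_cases h2 : r + 6 * k + 6 ≤ 6 * i
      · refine ⟨r+1, r+2, r+3, ?_⟩
        refine ⟨by omega, by omega, by omega, by omega, ?_, ?_, ?_, ?_, by omega, by omega, by omega, ?_⟩
        on_goal 4 => rintro t t1 t2 t3 t4 (⟨u, v | v | v⟩ | ⟨u, v | v | v⟩) <;> omega
        all_goals first
          | exact Or.inl ⟨by omega, Or.inl (by omega)⟩
          | exact Or.inl ⟨by omega, Or.inr (Or.inl (by omega))⟩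
          | exact Or.inl ⟨by omega, Or.inr (Or.inr (by omega))⟩
          | exact Or.inl ⟨by omega, Or.inr (Or.inr (Or.inl (by omega)))⟩
          | exact Or.inl ⟨by omega, Or.inr (Or.inr (Or.inr (Or.inl (by omega))))⟩
          | exact Or.inl ⟨by omega, Or.inr (Or.inr (Or.inr (Or.inr (by omega))))⟩
          | exact Or.inr ⟨by omega, Or.inl (by omega)⟩
          | exact Or.inr ⟨by omega, Or.inr (Or.inl (by omega))⟩
          | exact Or.inr ⟨by omega, Or.inr (Or.inr (by omega))⟩
          | exact Or.inr ⟨by omega, Or.inr (Or.inr (Or.inl (by omega)))⟩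
          | exact Or.inr ⟨by omega, Or.inr (Or.inr (Or.inr (Or.inl (by omega))))⟩
          | exact Or.inr ⟨by omega, Or.inr (Or.inr (Or.inr (Or.inr (by omega))))⟩
      · by_cases h3 : r + 10 ≤ 6 * i
        · refine ⟨r+2, r+4, r+6, ?_⟩
          refine ⟨by omega, by omega, by omega, by omega, ?_, ?_, ?_, ?_, by omega, by omega, by omega, ?_⟩
          on_goal 4 => rintro t t1 t2 t3 t4 (⟨u, v | v | v⟩ | ⟨u, v | v | v⟩) <;> omega
          all_goals first
            | exact Or.inl ⟨by omega, Or.inl (by omega)⟩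
            | exact Or.inl ⟨by omega, Or.inr (Or.inl (by omega))⟩
            | exact Or.inl ⟨by omega, Or.inr (Or.inr (by omega))⟩
            | exact Or.inl ⟨by omega, Or.inr (Or.inr (Or.inl (by omega)))⟩
            | exact Or.inl ⟨by omega, Or.inr (Or.inr (Or.inr (Or.inl (by omega))))⟩
            | exact Or.inl ⟨by omega, Or.inr (Or.inr (Or.inr (Or.inr (by omega))))⟩
            | exact Or.inr ⟨by omega, Or.inl (by omega)⟩
            | exact Or.inr ⟨by omega, Or.inr (Or.inl (by omega))⟩
            | exact Or.inr ⟨by omega, Or.inr (Or.inr (by omega))⟩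
            | exact Or.inr ⟨by omega, Or.inr (Or.inr (Or.inl (by omega)))⟩
            | exact Or.inr ⟨by omega, Or.inr (Or.inr (Or.inr (Or.inl (by omega))))⟩
            | exact Or.inr ⟨by omega, Or.inr (Or.inr (Or.inr (Or.inr (by omega))))⟩
        · refine ⟨r+2, r+4, 6*k+3, ?_⟩
          refine ⟨by omega, by omega, by omega, by omega, ?_, ?_, ?_, ?_, by omega, by omega, by omega, ?_⟩
          on_goal 4 => rintro t t1 t2 t3 t4 (⟨u, v | v | v⟩ | ⟨u, v | v | v⟩) <;> omega
          all_goals first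
            | exact Or.inl ⟨by omega, Or.inl (by omega)⟩
            | exact Or.inl ⟨by omega, Or.inr (Or.inl (by omega))⟩
            | exact Or.inl ⟨by omega, Or.inr (Or.inr (by omega))⟩
            | exact Or.inl ⟨by omega, Or.inr (Or.inr (Or.inl (by omega)))⟩
            | exact Or.inl ⟨by omega, Or.inr (Or.inr (Or.inr (Or.inl (by omega))))⟩
            | exact Or.inl ⟨by omega, Or.inr (Or.inr (Or.inr (Or.inr (by omega))))⟩
            | exact Or.inr ⟨by omega, Or.inl (by omega)⟩
            | exact Or.inr ⟨by omega, Or.inr (Or.inl (by omega))⟩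
            | exact Or.inr ⟨by omega, Or.inr (Or.inr (by omega))⟩
            | exact Or.inr ⟨by omega, Or.inr (Or.inr (Or.inl (by omega)))⟩
            | exact Or.inr ⟨by omega, Or.inr (Or.inr (Or.inr (Or.inl (by omega))))⟩
            | exact Or.inr ⟨by omega, Or.inr (Or.inr (Or.inr (Or.inr (by omega))))⟩
  · by_cases h1 : r = 12 * k + 3
    · refine ⟨r+1, r+2, r+3, ?_⟩
      refine ⟨by omega, by omega, by omega, by omega, ?_, ?_, ?_, ?_, by omega, by omega, by omega, ?_⟩
      on_goal 4 => rintro t t1 t2 t3 t4 (⟨u, v | v | v⟩ | ⟨u, v | v | v⟩) <;> omega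
      all_goals first
        | exact Or.inl ⟨by omega, Or.inl (by omega)⟩
        | exact Or.inl ⟨by omega, Or.inr (Or.inl (by omega))⟩
        | exact Or.inl ⟨by omega, Or.inr (Or.inr (by omega))⟩
        | exact Or.inl ⟨by omega, Or.inr (Or.inr (Or.inl (by omega)))⟩
        | exact Or.inl ⟨by omega, Or.inr (Or.inr (Or.inr (Or.inl (by omega))))⟩
        | exact Or.inl ⟨by omega, Or.inr (Or.inr (Or.inr (Or.inr (by omega))))⟩
        | exact Or.inr ⟨by omega, Or.inl (by omega)⟩
        | exact Or.inr ⟨by omega, Or.inr (Or.inl (by omega))⟩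
        | exact Or.inr ⟨by omega, Or.inr (Or.inr (by omega))⟩
        | exact Or.inr ⟨by omega, Or.inr (Or.inr (Or.inl (by omega)))⟩
        | exact Or.inr ⟨by omega, Or.inr (Or.inr (Or.inr (Or.inl (by omega))))⟩
        | exact Or.inr ⟨by omega, Or.inr (Or.inr (Or.inr (Or.inr (by omega))))⟩
    · by_cases h2 : r + 6 ≤ 6 * k + 3 + 6 * i
      · refine ⟨r+2, r+4, r+6, ?_⟩
        refine ⟨by omega, by omega, by omega, by omega, ?_, ?_, ?_, ?_, by omega, by omega, by omega, ?_⟩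
        on_goal 4 => rintro t t1 t2 t3 t4 (⟨u, v | v | v⟩ | ⟨u, v | v | v⟩) <;> omega
        all_goals first
          | exact Or.inl ⟨by omega, Or.inl (by omega)⟩
          | exact Or.inl ⟨by omega, Or.inr (Or.inl (by omega))⟩
          | exact Or.inl ⟨by omega, Or.inr (Or.inr (by omega))⟩
          | exact Or.inl ⟨by omega, Or.inr (Or.inr (Or.inl (by omega)))⟩
          | exact Or.inl ⟨by omega, Or.inr (Or.inr (Or.inr (Or.inl (by omega))))⟩
          | exact Or.inl ⟨by omega, Or.inr (Or.inr (Or.inr (Or.inr (by omega))))⟩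
          | exact Or.inr ⟨by omega, Or.inl (by omega)⟩
          | exact Or.inr ⟨by omega, Or.inr (Or.inl (by omega))⟩
          | exact Or.inr ⟨by omega, Or.inr (Or.inr (by omega))⟩
          | exact Or.inr ⟨by omega, Or.inr (Or.inr (Or.inl (by omega)))⟩
          | exact Or.inr ⟨by omega, Or.inr (Or.inr (Or.inr (Or.inl (by omega))))⟩
          | exact Or.inr ⟨by omega, Or.inr (Or.inr (Or.inr (Or.inr (by omega))))⟩
      · refine ⟨r+2, 12*k+4, 12*k+6, ?_⟩
        refine ⟨by omega, by omega, by omega, by omega, ?_, ?_, ?_, ?_, by omega, by omega, by omega, ?_⟩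
        on_goal 4 => rintro t t1 t2 t3 t4 (⟨u, v | v | v⟩ | ⟨u, v | v | v⟩) <;> omega
        all_goals first
          | exact Or.inl ⟨by omega, Or.inl (by omega)⟩
          | exact Or.inl ⟨by omega, Or.inr (Or.inl (by omega))⟩
          | exact Or.inl ⟨by omega, Or.inr (Or.inr (by omega))⟩
          | exact Or.inl ⟨by omega, Or.inr (Or.inr (Or.inl (by omega)))⟩
          | exact Or.inl ⟨by omega, Or.inr (Or.inr (Or.inr (Or.inl (by omega))))⟩
          | exact Or.inl ⟨by omega, Or.inr (Or.inr (Or.inr (Or.inr (by omega))))⟩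
          | exact Or.inr ⟨by omega, Or.inl (by omega)⟩
          | exact Or.inr ⟨by omega, Or.inr (Or.inl (by omega))⟩
          | exact Or.inr ⟨by omega, Or.inr (Or.inr (by omega))⟩
          | exact Or.inr ⟨by omega, Or.inr (Or.inr (Or.inl (by omega)))⟩
          | exact Or.inr ⟨by omega, Or.inr (Or.inr (Or.inr (Or.inl (by omega))))⟩
          | exact Or.inr ⟨by omega, Or.inr (Or.inr (Or.inr (Or.inr (by omega))))⟩
  · by_cases h1 : r + 7 ≤ 6 * i
    · refine ⟨r+1, r+2, r+3, ?_⟩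
      refine ⟨by omega, by omega, by omega, by omega, ?_, ?_, ?_, ?_, by omega, by omega, by omega, ?_⟩
      on_goal 4 => rintro t t1 t2 t3 t4 (⟨u, v | v | v⟩ | ⟨u, v | v | v⟩) <;> omega
      all_goals first
        | exact Or.inl ⟨by omega, Or.inl (by omega)⟩
        | exact Or.inl ⟨by omega, Or.inr (Or.inl (by omega))⟩
        | exact Or.inl ⟨by omega, Or.inr (Or.inr (by omega))⟩
        | exact Or.inl ⟨by omega, Or.inr (Or.inr (Or.inl (by omega)))⟩
        | exact Or.inl ⟨by omega, Or.inr (Or.inr (Or.inr (Or.inl (by omega))))⟩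
        | exact Or.inl ⟨by omega, Or.inr (Or.inr (Or.inr (Or.inr (by omega))))⟩
        | exact Or.inr ⟨by omega, Or.inl (by omega)⟩
        | exact Or.inr ⟨by omega, Or.inr (Or.inl (by omega))⟩
        | exact Or.inr ⟨by omega, Or.inr (Or.inr (by omega))⟩
        | exact Or.inr ⟨by omega, Or.inr (Or.inr (Or.inl (by omega)))⟩
        | exact Or.inr ⟨by omega, Or.inr (Or.inr (Or.inr (Or.inl (by omega))))⟩
        | exact Or.inr ⟨by omega, Or.inr (Or.inr (Or.inr (Or.inr (by omega))))⟩
    · refine ⟨r+1, r+2, r+4, ?_⟩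
      refine ⟨by omega, by omega, by omega, by omega, ?_, ?_, ?_, ?_, by omega, by omega, by omega, ?_⟩
      on_goal 4 => rintro t t1 t2 t3 t4 (⟨u, v | v | v⟩ | ⟨u, v | v | v⟩) <;> omega
      on_goal 4 => by_cases hi : i = 2 * k
      all_goals first
        | exact Or.inl ⟨by omega, Or.inl (by omega)⟩
        | exact Or.inl ⟨by omega, Or.inr (Or.inl (by omega))⟩
        | exact Or.inl ⟨by omega, Or.inr (Or.inr (by omega))⟩
        | exact Or.inl ⟨by omega, Or.inr (Or.inr (Or.inl (by omega)))⟩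
        | exact Or.inl ⟨by omega, Or.inr (Or.inr (Or.inr (Or.inl (by omega))))⟩
        | exact Or.inl ⟨by omega, Or.inr (Or.inr (Or.inr (Or.inr (by omega))))⟩
        | exact Or.inr ⟨by omega, Or.inl (by omega)⟩
        | exact Or.inr ⟨by omega, Or.inr (Or.inl (by omega))⟩
        | exact Or.inr ⟨by omega, Or.inr (Or.inr (by omega))⟩
        | exact Or.inr ⟨by omega, Or.inr (Or.inr (Or.inl (by omega)))⟩
        | exact Or.inr ⟨by omega, Or.inr (Or.inr (Or.inr (Or.inl (by omega))))⟩
        | exact Or.inr ⟨by omega, Or.inr (Or.inr (Or.inr (Or.inr (by omega))))⟩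
  · refine ⟨r+1, r+2, r+3, ?_⟩
    refine ⟨by omega, by omega, by omega, by omega, ?_, ?_, ?_, ?_, by omega, by omega, by omega, ?_⟩
    on_goal 4 => rintro t t1 t2 t3 t4 (⟨u, v | v | v⟩ | ⟨u, v | v | v⟩) <;> omega
    all_goals first
      | exact Or.inl ⟨by omega, Or.inl (by omega)⟩
      | exact Or.inl ⟨by omega, Or.inr (Or.inl (by omega))⟩
      | exact Or.inl ⟨by omega, Or.inr (Or.inr (by omega))⟩
      | exact Or.inl ⟨by omega, Or.inr (Or.inr (Or.inl (by omega)))⟩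
      | exact Or.inl ⟨by omega, Or.inr (Or.inr (Or.inr (Or.inl (by omega))))⟩
      | exact Or.inl ⟨by omega, Or.inr (Or.inr (Or.inr (Or.inr (by omega))))⟩
      | exact Or.inr ⟨by omega, Or.inl (by omega)⟩
      | exact Or.inr ⟨by omega, Or.inr (Or.inl (by omega))⟩
      | exact Or.inr ⟨by omega, Or.inr (Or.inr (by omega))⟩
      | exact Or.inr ⟨by omega, Or.inr (Or.inr (Or.inl (by omega)))⟩
      | exact Or.inr ⟨by omega, Or.inr (Or.inr (Or.inr (Or.inl (by omega))))⟩
      | exact Or.inr ⟨by omega, Or.inr (Or.inr (Or.inr (Or.inr (by omega))))⟩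

/-- The semigroup. -/
def GG (k : ℕ) : AddSubmonoid ℕ :=
  AddSubmonoid.closure ({6 * k + 3, 6 * k + 5, 12 * k + 4} : Set ℕ)

lemma mem_GG (k x : ℕ) : x ∈ GG k ↔
    ∃ a b c : ℕ, x = a * (6 * k + 3) + b * (6 * k + 5) + c * (12 * k + 4) := by
  constructor
  · intro h
    induction h using AddSubmonoid.closure_induction with
    | mem x hx =>
      simp only [Set.mem_insert_iff, Set.mem_singleton_iff] at hx
      rcases hx with h | h | h
      · exact ⟨1, 0, 0, by simp [h]⟩
      · exact ⟨0, 1, 0, by simp [h]⟩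
      · exact ⟨0, 0, 1, by simp [h]⟩
    | zero => exact ⟨0, 0, 0, by simp⟩
    | add x y _ _ hx hy =>
      obtain ⟨a, b, c, rfl⟩ := hx
      obtain ⟨a', b', c', rfl⟩ := hy
      exact ⟨a + a', b + b', c + c', by ring⟩
  · rintro ⟨a, b, c, rfl⟩
    have e1 : (6 * k + 3) ∈ GG k := AddSubmonoid.subset_closure (by simp)
    have e2 : (6 * k + 5) ∈ GG k := AddSubmonoid.subset_closure (by simp)
    have e3 : (12 * k + 4) ∈ GG k := AddSubmonoid.subset_closure (by simp)
    have f1 := (GG k).nsmul_mem e1 a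
    have f2 := (GG k).nsmul_mem e2 b
    have f3 := (GG k).nsmul_mem e3 c
    simp only [smul_eq_mul] at f1 f2 f3
    exact (GG k).add_mem ((GG k).add_mem f1 f2) f3

lemma mem_GG' (k x : ℕ) : x ∈ GG k ↔ ∃ j s : ℕ, x = j * (12 * k + 4) + s ∧
    ((s % 2 = 0 ∧ s ≤ 6 * j) ∨ (s % 2 = 1 ∧ 6 * k + 3 ≤ s ∧ s ≤ 6 * k + 5 + 6 * j)) := by
  rw [mem_GG]
  constructor
  · rintro ⟨a, b, c, rfl⟩
    rcases Nat.even_or_odd' (a + b) with ⟨p, hp | hp⟩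
    · refine ⟨p + c, 2 * p + 2 * b, ?_, by omega⟩
      have ha : (a : ℤ) = 2 * p - b := by omega
      zify
      rw [ha]; ring
    · refine ⟨p + c, 2 * p + 2 * b + (6 * k + 3), ?_, by omega⟩
      have ha : (a : ℤ) = 2 * p + 1 - b := by omega
      zify
      rw [ha]; ring
  · rintro ⟨j, s, rfl, ⟨h1, h2⟩ | ⟨h1, h2, h3⟩⟩
    · obtain ⟨p, b, a, c, e1, e2, e3⟩ : ∃ p b a c : ℕ, s = 2 * p + 2 * b ∧ a + b = 2 * p ∧ j = p + c :=
        ⟨(s / 2 + 2) / 3, s / 2 - (s / 2 + 2) / 3, 2 * ((s / 2 + 2) / 3) - (s / 2 - (s / 2 + 2) / 3),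
          j - (s / 2 + 2) / 3, by omega, by omega, by omega⟩
      refine ⟨a, b, c, ?_⟩
      have ha : (a : ℤ) = 2 * p - b := by omega
      subst e1 e3
      zify
      rw [ha]; ring
    · obtain ⟨h, rfl⟩ : ∃ h, s = 6 * k + 3 + 2 * h := ⟨(s - (6 * k + 3)) / 2, by omega⟩
      obtain ⟨p, b, a, c, e1, e2, e3⟩ : ∃ p b a c : ℕ, h = p + b ∧ a + b = 2 * p + 1 ∧ j = p + c :=
        ⟨(h + 1) / 3, h - (h + 1) / 3, 2 * ((h + 1) / 3) + 1 - (h - (h + 1) / 3),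
          j - (h + 1) / 3, by omega, by omega, by omega⟩
      refine ⟨a, b, c, ?_⟩
      have ha : (a : ℤ) = 2 * p + 1 - b := by omega
      subst e1 e3
      zify
      rw [ha]; ring

lemma mem_MM (k i r : ℕ) (hr : r < 12 * k + 4) : i * (12 * k + 4) + r ∈ GG k ↔ MM k i r := by
  rw [mem_GG']
  constructor
  · rintro ⟨j, s, e, h⟩
    have hji : j ≤ i := by
      by_contra hc
      have : (i + 1) * (12 * k + 4) ≤ j * (12 * k + 4) := Nat.mul_le_mul_right _ (by omega)
      have h2 : (i + 1) * (12 * k + 4) = i * (12 * k + 4) + (12 * k + 4) := by ring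
      omega
    obtain ⟨d, rfl⟩ := Nat.exists_eq_add_of_le hji
    have e2 : (j + d) * (12 * k + 4) = j * (12 * k + 4) + 2 * (d * (6 * k + 2)) := by ring
    have e3 : d = 0 ∨ 6 * k + 2 ≤ d * (6 * k + 2) := by
      rcases Nat.eq_zero_or_pos d with h | h
      · exact Or.inl h
      · exact Or.inr (Nat.le_mul_of_pos_left _ h)
    rw [e2] at e
    unfold MM
    rcases e3 with rfl | e3
    · simp at e; omega
    · have e4 : d ≠ 0 := by rintro rfl; omega
      generalize d * (6 * k + 2) = D at *
      omega
  · rintro (h | h | h)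
    · exact ⟨i, r, rfl, by omega⟩
    · exact ⟨i, r, rfl, by omega⟩
    · obtain ⟨j, rfl⟩ : ∃ j, i = j + 1 := ⟨i - 1, by omega⟩
      exact ⟨j, r + (12 * k + 4), by ring, by omega⟩

lemma mem_NN (k i r : ℕ) (hr : r < 2 * (12 * k + 4)) :
    i * (12 * k + 4) + r ∈ GG k ↔ NN k i r := by
  unfold NN
  by_cases h : r < 12 * k + 4
  · rw [mem_MM k i r h]; simp [h]
  · have e : i * (12 * k + 4) + r = (i + 1) * (12 * k + 4) + (r - (12 * k + 4)) := by
      rw [add_mul]; omega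
    rw [e, mem_MM k _ _ (by omega)]
    simp [h, not_lt.mp h]

lemma mem_big (k x : ℕ) (hx : 2 * k * (12 * k + 4) + (12 * k + 3) ≤ x) : x ∈ GG k := by
  have h0 := Nat.div_add_mod x (12 * k + 4)
  have h1 : x % (12 * k + 4) < 12 * k + 4 := Nat.mod_lt _ (by omega)
  rw [mul_comm] at h0
  generalize x / (12 * k + 4) = i at *
  generalize x % (12 * k + 4) = r at *
  subst h0
  rw [mem_MM k i r h1]
  have h2 : 2 * k ≤ i := by
    by_contra hc
    have : (i + 1) * (12 * k + 4) ≤ 2 * k * (12 * k + 4) := Nat.mul_le_mul_right _ (by omega)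
    rw [add_mul] at this
    omega
  unfold MM
  rcases Nat.eq_or_lt_of_le h2 with h3 | h3
  · subst h3; omega
  · omega

/-- First elements of triples. -/
def Start (k x : ℕ) : Prop :=
  (∃ i r, r < 12 * k + 4 ∧ PP k i r ∧ x = i * (12 * k + 4) + r) ∨
    2 * k * (12 * k + 4) + (12 * k + 3) ≤ x

lemma start_step (k x : ℕ) (hk : 0 < k) (h : Start k x) : ∃ y z w, x < y ∧ y < z ∧ z < w ∧
    y ∈ GG k ∧ z ∈ GG k ∧ w ∈ GG k ∧ (∀ t, x < t → t < w → t ≠ y → t ≠ z → t ∉ GG k) ∧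
    x % 3 ≠ y % 3 ∧ y % 3 ≠ z % 3 ∧ x % 3 ≠ z % 3 ∧ Start k w := by
  have big : 2 * k * (12 * k + 4) + (12 * k + 3) ≤ x → ∃ y z w, x < y ∧ y < z ∧ z < w ∧
    y ∈ GG k ∧ z ∈ GG k ∧ w ∈ GG k ∧ (∀ t, x < t → t < w → t ≠ y → t ≠ z → t ∉ GG k) ∧
    x % 3 ≠ y % 3 ∧ y % 3 ≠ z % 3 ∧ x % 3 ≠ z % 3 ∧ Start k w := by
    intro h
    exact ⟨x + 1, x + 2, x + 3, by omega, by omega, by omega, mem_big _ _ (by omega),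
      mem_big _ _ (by omega), mem_big _ _ (by omega), fun t _ _ _ _ => by omega,
      by omega, by omega, by omega, Or.inr (by omega)⟩
  rcases h with ⟨i, r, hr, hp, rfl⟩ | h
  · by_cases hne : i = 2 * k ∧ r = 12 * k + 3
    · obtain ⟨rfl, rfl⟩ := hne
      exact big le_rfl
    · obtain ⟨a, b, c, h1, h2, h3, h4, h5, h6, h7, h8, h9, h10, h11, h12⟩ :=
        step_exists k i r hk hr hp hne
      refine ⟨i * (12 * k + 4) + a, i * (12 * k + 4) + b, i * (12 * k + 4) + c,
        by omega, by omega, by omega, (mem_NN k i a (by omega)).2 h5,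
        (mem_NN k i b (by omega)).2 h6, (mem_NN k i c (by omega)).2 h7, ?_,
        by omega, by omega, by omega, ?_⟩
      · intro t t1 t2 t3 t4
        obtain ⟨u, rfl⟩ : ∃ u, t = i * (12 * k + 4) + u := ⟨t - i * (12 * k + 4), by omega⟩
        rw [mem_NN k i u (by omega)]
        exact h8 u (by omega) (by omega) (by omega) (by omega)
      · left
        rcases h12 with ⟨q1, q2⟩ | ⟨q1, q2⟩
        · exact ⟨i, c, q1, q2, rfl⟩
        · exact ⟨i + 1, _, by omega, q2, by rw [add_mul]; omega⟩
  · exact big h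

lemma nth_next (p : ℕ → Prop) (hp : (Set.ofPred p).Infinite) (i x y : ℕ) (hx : Nat.nth p i = x)
    (hy : p y) (hxy : x < y) (hn : ∀ t, x < t → t < y → ¬ p t) : Nat.nth p (i + 1) = y := by
  subst hx
  obtain ⟨j, rfl⟩ : ∃ j, Nat.nth p j = y := by
    have := Nat.range_nth_of_infinite hp
    have h : y ∈ Set.range (Nat.nth p) := by rw [this]; exact hy
    exact h
  have hm := Nat.nth_strictMono hp
  have hij : i < j := hm.lt_iff_lt.1 hxy
  rcases Nat.eq_or_lt_of_le (Nat.succ_le_of_lt hij) with h | h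
  · rw [← h]
  · exact absurd (Nat.nth_mem_of_infinite hp (i + 1)) (hn _ (hm (Nat.lt_succ_self i)) (hm h))

lemma GG_inf (k : ℕ) : (Set.ofPred (fun x => x ∈ GG k ∧ 0 < x)).Infinite := by
  refine (Set.Ici_infinite (2 * k * (12 * k + 4) + (12 * k + 3))).mono ?_
  intro x hx
  have hx' : 2 * k * (12 * k + 4) + (12 * k + 3) ≤ x := hx
  exact ⟨mem_big k x hx', by omega⟩

lemma seq_step (k q x y : ℕ) (hx : posSeq (GG k) q = x) (hy : y ∈ GG k) (hxy : x < y)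
    (hn : ∀ t, x < t → t < y → t ∉ GG k) : posSeq (GG k) (q + 1) = y :=
  nth_next _ (GG_inf k) q x y hx ⟨hy, by omega⟩ hxy (fun t h1 h2 h3 => hn t h1 h2 h3.1)

lemma small (k t : ℕ) (ht : t < 12 * k + 4) (h : t ∈ GG k) : t = 0 ∨ t = 6 * k + 3 ∨ t = 6 * k + 5 := by
  have := (mem_MM k 0 t ht).1 (by simpa using h)
  unfold MM at this
  omega

lemma seq_zero (k : ℕ) (hk : 0 < k) : posSeq (GG k) 0 = 6 * k + 3 := by
  have hmem : (6 * k + 3) ∈ GG k := AddSubmonoid.subset_closure (by simp)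
  have h := Nat.nth_mem_of_infinite (GG_inf k) 0
  have hle : posSeq (GG k) 0 ≤ 6 * k + 3 := by
    obtain ⟨j, hj⟩ : (6 * k + 3) ∈ Set.range (posSeq (GG k)) := by
      unfold posSeq
      rw [Nat.range_nth_of_infinite (GG_inf k)]
      exact ⟨hmem, by omega⟩
    rw [← hj]
    exact (Nat.nth_strictMono (GG_inf k)).monotone (Nat.zero_le j)
  change posSeq (GG k) 0 ∈ GG k ∧ 0 < posSeq (GG k) 0 at h
  have := small k _ (by omega) h.1
  omega

lemma triple (k q x : ℕ) (hk : 0 < k) (hx : posSeq (GG k) q = x) (h : Start k x) :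
    posSeq (GG k) q % 3 ≠ posSeq (GG k) (q + 1) % 3 ∧
    posSeq (GG k) (q + 1) % 3 ≠ posSeq (GG k) (q + 2) % 3 ∧
    posSeq (GG k) q % 3 ≠ posSeq (GG k) (q + 2) % 3 ∧ Start k (posSeq (GG k) (q + 3)) := by
  obtain ⟨y, z, w, h1, h2, h3, hy, hz, hw, hn, r1, r2, r3, hs⟩ := start_step k x hk h
  have e1 := seq_step k q x y hx hy h1 (fun t a b => hn t a (by omega) (by omega) (by omega))
  have e2 := seq_step k _ y z e1 hz h2
    (fun t a b => hn t (by omega) (by omega) (by omega) (by omega))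
  have e3 := seq_step k _ z w e2 hw h3
    (fun t a b => hn t (by omega) (by omega) (by omega) (by omega))
  rw [e3, e2, e1, hx]
  exact ⟨r1, r2, r3, hs⟩

lemma start_all (k q : ℕ) (hk : 0 < k) : Start k (posSeq (GG k) (q * 3)) := by
  induction q with
  | zero =>
    rw [zero_mul, seq_zero k hk]
    left
    refine ⟨0, 6 * k + 3, by omega, ?_, by simp⟩
    unfold PP
    omega
  | succ q ih =>
    have := (triple k _ _ hk rfl ih).2.2.2
    rwa [show (q + 1) * 3 = q * 3 + 3 by ring]

theorem family10_is_three_permutation (k : ℕ) (hk : 0 < k) :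
    IsPermutationSemigroup 3 (AddSubmonoid.closure ({6 * k + 3, 6 * k + 5, 12 * k + 4} : Set ℕ)) := by
  change IsPermutationSemigroup 3 (GG k)
  refine ⟨?_, ?_, ?_⟩
  · refine (Set.finite_Iio (2 * k * (12 * k + 4) + (12 * k + 3))).subset ?_
    intro x hx
    by_contra hc
    exact hx (mem_big k x (not_lt.1 hc))
  · have e0 := seq_zero k hk
    have e1 : posSeq (GG k) 1 = 6 * k + 5 :=
      seq_step k 0 _ _ e0 (AddSubmonoid.subset_closure (by simp)) (by omega)
        (fun t h1 h2 h3 => by have := small k t (by omega) h3; omega)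
    have e2 : posSeq (GG k) 2 = 12 * k + 4 :=
      seq_step k 1 _ _ e1 (AddSubmonoid.subset_closure (by simp)) (by omega)
        (fun t h1 h2 h3 => by have := small k t (by omega) h3; omega)
    have : posSeq (GG k) '' Set.Iio 3 = ({6 * k + 3, 6 * k + 5, 12 * k + 4} : Set ℕ) := by
      ext x
      simp only [Set.mem_image, Set.mem_Iio, Set.mem_insert_iff, Set.mem_singleton_iff]
      constructor
      · rintro ⟨n, hn, rfl⟩
        interval_cases n <;> omega
      · rintro (rfl | rfl | rfl)
        · exact ⟨0, by omega, e0⟩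
        · exact ⟨1, by omega, e1⟩
        · exact ⟨2, by omega, e2⟩
    rw [this]
    rfl
  · intro q
    obtain ⟨r1, r2, r3, -⟩ := triple k _ _ hk rfl (start_all k q hk)
    rw [Fintype.bijective_iff_injective_and_card]
    refine ⟨?_, by simp⟩
    intro a b hab
    have hab' := (ZMod.natCast_eq_natCast_iff' _ _ 3).1 hab
    fin_cases a <;> fin_cases b <;> simp at hab' ⊢ <;> omega
end

section
/- For every positive integer k, the numerical semigroup generated by S = {6k+4, 6k+5, 9k+6} is a 3-permutation numerical semigroup. -/
/-- The `(m, r)` value of the enumeration, with `d = 3k+2`. -/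
def enumAux (d m r : ℕ) : ℕ :=
  if m < d then (if r ≤ m then 2 * (m * d) + r else 2 * (m * d) + d + (r - m - 1))
  else m * m + r + d * d

/-- The explicit enumeration. -/
def enumF (d t : ℕ) : ℕ := enumAux d (Nat.sqrt (t + 1)) (t + 1 - Nat.sqrt (t + 1) * Nat.sqrt (t + 1))

lemma enumF_eq (d t m r : ℕ) (h : t + 1 = m * m + r) (hr : r ≤ 2 * m) :
    enumF d t = enumAux d m r := by
  have : Nat.sqrt (t + 1) = m := by
    rw [h]; exact Nat.sqrt_add_eq m (by omega)
  unfold enumF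
  rw [this]
  congr 1
  omega

lemma exists_mr (t : ℕ) : ∃ m r, t + 1 = m * m + r ∧ r ≤ 2 * m ∧ 1 ≤ m := by
  refine ⟨Nat.sqrt (t + 1), t + 1 - Nat.sqrt (t + 1) * Nat.sqrt (t + 1), ?_, ?_, ?_⟩
  · have := Nat.sqrt_le (t + 1); omega
  · have := Nat.sqrt_le_add (t + 1); omega
  · exact Nat.le_sqrt.2 (by omega)

lemma enumF_step (d : ℕ) (hd : d % 3 = 2) (t : ℕ) :
    enumF d t < enumF d (t + 1) ∧
      (t % 3 ≠ 2 → enumF d (t + 1) % 3 = (enumF d t + 1) % 3) := by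
  obtain ⟨m, r, h, hr, hm⟩ := exists_mr t
  rw [enumF_eq d t m r h hr]
  have hP : (m * d) % 3 = (m % 3 * 2) % 3 := by rw [Nat.mul_mod, hd]
  have hQ : (m * m) % 3 = ((m % 3) * (m % 3)) % 3 := Nat.mul_mod _ _ _
  have hi : m % 3 = 0 ∨ m % 3 = 1 ∨ m % 3 = 2 := by omega
  rcases Nat.lt_or_ge r (2 * m) with hlt | hge
  · rw [enumF_eq d (t + 1) m (r + 1) (by omega) (by omega)]
    unfold enumAux
    generalize m * d = P at *
    generalize m * m = Q at *
    split_ifs <;> rcases hi with hi | hi | hi <;> simp only [hi] at hP hQ <;>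
      constructor <;> omega
  · have hr2 : r = 2 * m := by omega
    subst hr2
    have e1 : (m + 1) * (m + 1) = m * m + 2 * m + 1 := by ring
    have e2 : (m + 1) * d = m * d + d := by ring
    rw [enumF_eq d (t + 1) (m + 1) 0 (by omega) (by omega)]
    unfold enumAux
    rw [e1, e2]
    by_cases h1 : m + 1 < d
    · generalize m * d = P at *
      generalize m * m = Q at *
      split_ifs <;> rcases hi with hi | hi | hi <;> simp only [hi] at hP hQ <;>
        constructor <;> omega
    · by_cases h2 : m + 1 = d
      · subst h2
        rw [e1]
        have e3 : m * (m + 1) = m * m + m := by ring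
        rw [e3]
        generalize m * m = Q at *
        split_ifs <;> rcases hi with hi | hi | hi <;> simp only [hi] at hP hQ <;>
          constructor <;> omega
      · generalize m * d = P at *
        generalize m * m = Q at *
        split_ifs <;> rcases hi with hi | hi | hi <;> simp only [hi] at hP hQ <;>
          constructor <;> omega

lemma mem_iff (k x : ℕ) :
    x ∈ AddSubmonoid.closure ({6 * k + 4, 6 * k + 5, 9 * k + 6} : Set ℕ) ↔
      ∃ m j, j ≤ m ∧ (x = 2 * (m * (3 * k + 2)) + j ∨
        x = 2 * (m * (3 * k + 2)) + 3 * (3 * k + 2) + j) := by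
  constructor
  · intro hx
    induction hx using AddSubmonoid.closure_induction with
    | mem y hy =>
      simp only [Set.mem_insert_iff, Set.mem_singleton_iff] at hy
      rcases hy with rfl | rfl | rfl
      · exact ⟨1, 0, by omega, by omega⟩
      · exact ⟨1, 1, by omega, by omega⟩
      · exact ⟨0, 0, by omega, by omega⟩
    | zero => exact ⟨0, 0, by omega, by omega⟩
    | add y z _ _ hy hz =>
      obtain ⟨m, j, hj, h⟩ := hy
      obtain ⟨m', j', hj', h'⟩ := hz
      rcases h with rfl | rfl <;> rcases h' with rfl | rfl
      · exact ⟨m + m', j + j', by omega, Or.inl (by ring)⟩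
      · exact ⟨m + m', j + j', by omega, Or.inr (by ring)⟩
      · exact ⟨m + m', j + j', by omega, Or.inr (by ring)⟩
      · exact ⟨m + m' + 3, j + j', by omega, Or.inl (by ring)⟩
  · have key : ∀ m j, j ≤ m → 2 * (m * (3 * k + 2)) + j ∈
        AddSubmonoid.closure ({6 * k + 4, 6 * k + 5, 9 * k + 6} : Set ℕ) := by
      intro m j hj
      obtain ⟨i, rfl⟩ := Nat.exists_eq_add_of_le hj
      have : 2 * ((j + i) * (3 * k + 2)) + j = i • (6 * k + 4) + j • (6 * k + 5) := by
        simp only [smul_eq_mul]; ring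
      rw [this]
      exact add_mem (nsmul_mem (AddSubmonoid.subset_closure (by simp)) _)
        (nsmul_mem (AddSubmonoid.subset_closure (by simp)) _)
    rintro ⟨m, j, hj, rfl | rfl⟩
    · exact key m j hj
    · have : 2 * (m * (3 * k + 2)) + 3 * (3 * k + 2) + j
          = (2 * (m * (3 * k + 2)) + j) + (9 * k + 6) := by ring
      rw [this]
      exact add_mem (key m j hj) (AddSubmonoid.subset_closure (by simp))

lemma mem_of_large (k x : ℕ) (hx : 2 * ((3 * k + 2) * (3 * k + 2)) ≤ x) :
    x ∈ AddSubmonoid.closure ({6 * k + 4, 6 * k + 5, 9 * k + 6} : Set ℕ) := by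
  rw [mem_iff]
  have hdpos : 0 < 3 * k + 2 := by omega
  generalize 3 * k + 2 = d at *
  have h1 : d * (x / d) + x % d = x := Nat.div_add_mod x d
  have h2 : x % d < d := Nat.mod_lt _ hdpos
  have h3 : 2 * d ≤ x / d := by
    rw [Nat.le_div_iff_mul_le hdpos]; linarith
  generalize x / d = n at *
  generalize x % d = j at *
  rcases Nat.even_or_odd' n with ⟨q, rfl | rfl⟩
  · exact ⟨q, j, by omega, Or.inl (by rw [← h1]; ring)⟩
  · obtain ⟨p, rfl⟩ : ∃ p, q = p + 1 := ⟨q - 1, by omega⟩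
    exact ⟨p, j, by omega, Or.inr (by rw [← h1]; ring)⟩

lemma enumF_mem (k t : ℕ) : enumF (3 * k + 2) t ∈
      AddSubmonoid.closure ({6 * k + 4, 6 * k + 5, 9 * k + 6} : Set ℕ) ∧
      0 < enumF (3 * k + 2) t := by
  obtain ⟨m, r, h, hr, hm⟩ := exists_mr t
  rw [enumF_eq _ t m r h hr]
  have hmd : 0 < m * (3 * k + 2) := by positivity
  unfold enumAux
  split_ifs with h1 h2
  · exact ⟨(mem_iff k _).2 ⟨m, r, h2, Or.inl rfl⟩, by omega⟩
  · refine ⟨(mem_iff k _).2 ⟨m - 1, r - m - 1, by omega, Or.inr ?_⟩, by omega⟩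
    obtain ⟨p, rfl⟩ : ∃ p, m = p + 1 := ⟨m - 1, by omega⟩
    simp only [Nat.add_sub_cancel]
    ring
  · have : (3 * k + 2) * (3 * k + 2) ≤ m * m := Nat.mul_le_mul (by omega) (by omega)
    exact ⟨mem_of_large k _ (by omega), by omega⟩

lemma enumF_surj (k x : ℕ)
    (hx : x ∈ AddSubmonoid.closure ({6 * k + 4, 6 * k + 5, 9 * k + 6} : Set ℕ))
    (hpos : 0 < x) : ∃ t, enumF (3 * k + 2) t = x := by
  have hdpos : 0 < 3 * k + 2 := by omega
  rw [mem_iff] at hx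
  generalize 3 * k + 2 = d at *
  have hdd : 0 < d * d := by positivity
  by_cases hl : 2 * (d * d) ≤ x
  · obtain ⟨m, r, h, hr, hm⟩ := exists_mr (x - d * d - 1)
    refine ⟨x - d * d - 1, ?_⟩
    rw [enumF_eq _ _ m r h hr]
    have : ¬ m < d := by
      intro hlt
      have : (m + 1) * (m + 1) ≤ d * d := Nat.mul_le_mul hlt hlt
      have e1 : (m + 1) * (m + 1) = m * m + 2 * m + 1 := by ring
      omega
    unfold enumAux
    rw [if_neg this]
    omega
  · obtain ⟨m, j, hj, h | h⟩ := hx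
    · have hm : m < d := by
        by_contra hc
        have : d * d ≤ m * d := Nat.mul_le_mul_right d (by omega)
        omega
      have hm0 : 1 ≤ m := by
        by_contra hc
        obtain rfl : m = 0 := by omega
        omega
      have : 1 ≤ m * m := Nat.mul_le_mul hm0 hm0
      refine ⟨m * m + j - 1, ?_⟩
      rw [enumF_eq _ _ m j (by omega) (by omega)]
      unfold enumAux
      rw [if_pos hm, if_pos hj, h]
    · have e2 : (m + 1) * d = m * d + d := by ring
      have hm : m + 1 < d := by
        by_contra hc
        have : d * d ≤ (m + 1) * d := Nat.mul_le_mul_right d (by omega)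
        omega
      refine ⟨(m + 1) * (m + 1) + (m + 1 + j), ?_⟩
      rw [enumF_eq _ _ (m + 1) (m + 2 + j) (by omega) (by omega)]
      unfold enumAux
      rw [if_pos hm, if_neg (by omega), h, e2]
      omega

lemma posSeq_eq (k : ℕ) (t : ℕ) :
    posSeq (AddSubmonoid.closure ({6 * k + 4, 6 * k + 5, 9 * k + 6} : Set ℕ)) t
      = enumF (3 * k + 2) t := by
  have hmono : StrictMono (enumF (3 * k + 2)) :=
    strictMono_nat_of_lt_succ fun t => (enumF_step _ (by omega) t).1
  unfold posSeq
  rw [← Nat.nth_comp_of_strictMono hmono]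
  · congr 1
    have : (fun i => enumF (3 * k + 2) i ∈
        AddSubmonoid.closure ({6 * k + 4, 6 * k + 5, 9 * k + 6} : Set ℕ) ∧
        0 < enumF (3 * k + 2) i) = fun _ => True := by
      funext i
      exact eq_true (enumF_mem k i)
    rw [this]
    exact Nat.nth_true t
  · rintro x ⟨hx, h0⟩
    exact enumF_surj k x hx h0
  · intro hfin
    exfalso
    refine (Set.infinite_range_of_injective hmono.injective) (hfin.subset ?_)
    rintro _ ⟨t, rfl⟩
    exact enumF_mem k t

theorem family11_is_three_permutation (k : ℕ) (hk : 0 < k) :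
    IsPermutationSemigroup 3 (AddSubmonoid.closure ({6 * k + 4, 6 * k + 5, 9 * k + 6} : Set ℕ)) := by
  refine ⟨?_, ?_, ?_⟩
  · refine (Set.finite_Iio (2 * ((3 * k + 2) * (3 * k + 2)))).subset ?_
    intro x hx
    by_contra hc
    exact hx (mem_of_large k x (by simpa using hc))
  · have h0 : enumF (3 * k + 2) 0 = 6 * k + 4 := by
      rw [enumF_eq _ 0 1 0 (by omega) (by omega)]
      unfold enumAux
      rw [if_pos (by omega), if_pos (by omega)]; omega
    have h1 : enumF (3 * k + 2) 1 = 6 * k + 5 := by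
      rw [enumF_eq _ 1 1 1 (by omega) (by omega)]
      unfold enumAux
      rw [if_pos (by omega), if_pos (by omega)]; omega
    have h2 : enumF (3 * k + 2) 2 = 9 * k + 6 := by
      rw [enumF_eq _ 2 1 2 (by omega) (by omega)]
      unfold enumAux
      rw [if_pos (by omega), if_neg (by omega)]; omega
    congr 1
    ext x
    simp only [Set.mem_insert_iff, Set.mem_singleton_iff, Set.mem_image, Set.mem_Iio, posSeq_eq]
    constructor
    · rintro (rfl | rfl | rfl)
      · exact ⟨0, by omega, h0⟩
      · exact ⟨1, by omega, h1⟩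
      · exact ⟨2, by omega, h2⟩
    · rintro ⟨t, ht, rfl⟩
      interval_cases t
      · exact Or.inl h0
      · exact Or.inr (Or.inl h1)
      · exact Or.inr (Or.inr h2)
  · intro s
    have hs1 := (enumF_step (3 * k + 2) (by omega) (s * 3)).2 (by omega)
    have hs2 := (enumF_step (3 * k + 2) (by omega) (s * 3 + 1)).2 (by omega)
    rw [show s * 3 + 1 + 1 = s * 3 + 2 from rfl] at hs2
    rw [Fintype.bijective_iff_injective_and_card]
    refine ⟨?_, by simp⟩
    intro i j hij
    simp only [posSeq_eq] at hij
    rw [ZMod.natCast_eq_natCast_iff'] at hij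
    fin_cases i <;> fin_cases j <;> simp at hij ⊢ <;> omega
end

section
/- For every positive integer k, the numerical semigroup generated by S = {6k+5, 9k+6, 9k+7} is a 3-permutation numerical semigroup. -/
theorem f13_mem (k g : ℕ) :
    g ∈ AddSubmonoid.closure ({6 * k + 5, 9 * k + 6, 9 * k + 7} : Set ℕ) ↔
      ∃ n t, g = n * (3 * k + 2) + t ∧ (2 * n) % 3 ≤ t ∧ t ≤ n / 2 := by
  constructor
  · intro h
    induction h using AddSubmonoid.closure_induction with
    | mem x hx =>
      rcases hx with rfl | rfl | rfl
      · exact ⟨2, 1, by ring, by norm_num, by norm_num⟩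
      · exact ⟨3, 0, by ring, by norm_num, by norm_num⟩
      · exact ⟨3, 1, by ring, by norm_num, by norm_num⟩
    | zero => exact ⟨0, 0, by ring, by norm_num, by norm_num⟩
    | add x y _ _ ihx ihy =>
      obtain ⟨n, t, rfl, h1, h2⟩ := ihx
      obtain ⟨m, u, rfl, h3, h4⟩ := ihy
      exact ⟨n + m, t + u, by ring, by omega, by omega⟩
  · rintro ⟨n, t, rfl, h1, h2⟩
    have key : ∃ x y z, n = 2 * x + 3 * y + 3 * z ∧ t = x + z := by
      by_cases h : n ≤ 3 * t
      · exact ⟨3 * t - n, 0, n - 2 * t, by omega, by omega⟩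
      · exact ⟨(2 * n) % 3, (n - 2 * ((2 * n) % 3)) / 3 - (t - (2 * n) % 3), t - (2 * n) % 3,
          by omega, by omega⟩
    obtain ⟨x, y, z, rfl, rfl⟩ := key
    have e : (2 * x + 3 * y + 3 * z) * (3 * k + 2) + (x + z)
        = x • (6 * k + 5) + y • (9 * k + 6) + z • (9 * k + 7) := by
      simp only [smul_eq_mul]; ring
    rw [e]
    refine add_mem (add_mem ?_ ?_) ?_ <;> refine AddSubmonoid.nsmul_mem _ ?_ _ <;>
      apply AddSubmonoid.subset_closure <;> simp

theorem f13_large (k g : ℕ) (hg : 2 * (3 * k + 2) * (3 * k + 2) + 2 ≤ g) :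
    ∃ n t, g = n * (3 * k + 2) + t ∧ (2 * n) % 3 ≤ t ∧ t ≤ n / 2 := by
  have h1 := Nat.div_add_mod g (3 * k + 2)
  have h2 := Nat.mod_lt g (show 0 < 3 * k + 2 by omega)
  set n := g / (3 * k + 2) with hn
  set t := g % (3 * k + 2)
  have h3 : 2 * (3 * k + 2) ≤ n := by
    rw [hn, Nat.le_div_iff_mul_le (by omega)]; omega
  have h4 : n = 2 * (3 * k + 2) → 2 ≤ t := by
    intro h; rw [h] at h1
    have : (3 * k + 2) * (2 * (3 * k + 2)) = 2 * (3 * k + 2) * (3 * k + 2) := by ring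
    omega
  by_cases h : (2 * n) % 3 ≤ t
  · exact ⟨n, t, by rw [← h1]; ring, h, by omega⟩
  · obtain ⟨m, hm⟩ : ∃ m, n = m + 1 := ⟨n - 1, by omega⟩
    refine ⟨m, t + (3 * k + 2), by rw [← h1, hm]; ring, by omega, ?_⟩
    clear_value n t
    clear h1 hg hn
    obtain ⟨r, rfl⟩ := Nat.exists_eq_add_of_le h3
    have e : 2 * (2 * (3 * k + 2) + r) % 3 = (2 * r + 2) % 3 := by omega
    rw [e] at h
    rcases r with _ | _ | _ | r
    · omega
    · norm_num at h; omega
    · norm_num at h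
    · omega

/-- Any semigroup element not below level `n + 1` start. -/
theorem f13_gap (k n g : ℕ) (hg : n * (3 * k + 2) + n / 2 < g)
    (h : ∃ n t, g = n * (3 * k + 2) + t ∧ (2 * n) % 3 ≤ t ∧ t ≤ n / 2) :
    (n + 1) * (3 * k + 2) + (2 * (n + 1)) % 3 ≤ g := by
  obtain ⟨m, t, rfl, h1, h2⟩ := h
  rcases lt_trichotomy m (n + 1) with hm | rfl | hm
  · have := Nat.mul_le_mul_right (3 * k + 2) (show m ≤ n by omega)
    omega
  · omega
  · have := Nat.mul_le_mul_right (3 * k + 2) (show n + 2 ≤ m by omega)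
    have e : (n + 2) * (3 * k + 2) = (n + 1) * (3 * k + 2) + (3 * k + 2) := by ring
    omega

def F13Inv (k i x : ℕ) : Prop :=
  2 * (3 * k + 2) * (3 * k + 2) + 2 ≤ x ∨
  ∃ n t, x = n * (3 * k + 2) + t ∧ (2 * n) % 3 ≤ t ∧ t ≤ n / 2 ∧ n < 2 * (3 * k + 2) ∧ 2 ≤ n ∧
    (2 * n + t) % 3 = (2 * (n / 2) + i) % 3

theorem f13_mod (k n t : ℕ) : (n * (3 * k + 2) + t) % 3 = (2 * n + t) % 3 := by
  have : n * (3 * k + 2) + t = 2 * n + t + 3 * (n * k) := by ring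
  rw [this]; omega

theorem f13_step (k i x : ℕ) (h : F13Inv k i x) :
    ∃ y, x < y ∧ (∃ n t, y = n * (3 * k + 2) + t ∧ (2 * n) % 3 ≤ t ∧ t ≤ n / 2) ∧
      (∀ g, x < g → (∃ n t, g = n * (3 * k + 2) + t ∧ (2 * n) % 3 ≤ t ∧ t ≤ n / 2) → y ≤ g) ∧
      F13Inv k (i + 1) y ∧ (i % 3 ≠ 2 → y % 3 = (x + 1) % 3) := by
  rcases h with h | ⟨n, t, rfl, h1, h2, h3, h5, h4⟩
  · exact ⟨x + 1, by omega, f13_large k _ (by omega), fun g hg _ => hg, Or.inl (by omega),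
      fun _ => rfl⟩
  · by_cases ht : t < n / 2
    · exact ⟨n * (3 * k + 2) + (t + 1), by omega, ⟨n, t + 1, rfl, by omega, by omega⟩,
        fun g hg _ => by omega, Or.inr ⟨n, t + 1, rfl, by omega, by omega, h3, h5, by omega⟩,
        fun _ => by rw [add_assoc]⟩
    · have ht' : t = n / 2 := by omega
      subst ht'
      have e : (n + 1) * (3 * k + 2) = n * (3 * k + 2) + (3 * k + 2) := by ring
      have hlt : n * (3 * k + 2) + n / 2 < (n + 1) * (3 * k + 2) + (2 * (n + 1)) % 3 := by omega
      have hs : (2 * (n + 1)) % 3 ≤ (n + 1) / 2 := by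
        clear e hlt h1 h2 h3 h4 ht
        by_cases hn : 3 ≤ n
        · omega
        · obtain rfl : n = 2 := by omega
          norm_num
      by_cases hn : n + 1 = 2 * (3 * k + 2)
      · have hC : 2 * (3 * k + 2) * (3 * k + 2) + 2 ≤ (n + 1) * (3 * k + 2) + (2 * (n + 1)) % 3 := by
          rw [hn]; omega
        refine ⟨_, hlt, f13_large k _ hC, fun g hg hG => f13_gap k n g hg hG, Or.inl hC, ?_⟩
        intro hi; exfalso; omega
      · refine ⟨_, hlt, ⟨n + 1, _, rfl, le_rfl, hs⟩, fun g hg hG => f13_gap k n g hg hG,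
          Or.inr ⟨n + 1, _, rfl, le_rfl, hs, by omega, by omega, ?_⟩, ?_⟩
        · clear e hlt hn h3 h1 h2 ht
          rcases Nat.even_or_odd' n with ⟨j, rfl | rfl⟩ <;> omega
        intro hi
        rw [f13_mod, add_assoc, f13_mod]
        clear e hlt hn h3 h1 h2 ht
        rcases Nat.even_or_odd' n with ⟨j, rfl | rfl⟩ <;> omega

theorem f13_next (P : ℕ → Prop) (hP : (Set.ofPred P).Infinite) (i y : ℕ)
    (h1 : Nat.nth P i < y) (h2 : P y) (h3 : ∀ g, Nat.nth P i < g → P g → y ≤ g) :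
    Nat.nth P (i + 1) = y := by
  apply le_antisymm
  · by_contra hc
    push Not at hc
    exact absurd (Nat.le_nth_of_lt_nth_succ hc h2) (by omega)
  · exact h3 _ (Nat.nth_strictMono hP (Nat.lt_succ_self i)) (Nat.nth_mem_of_infinite hP _)

theorem family13_is_three_permutation (k : ℕ) (hk : 0 < k) :
    IsPermutationSemigroup 3 (AddSubmonoid.closure ({6 * k + 5, 9 * k + 6, 9 * k + 7} : Set ℕ)) := by
  set G := AddSubmonoid.closure ({6 * k + 5, 9 * k + 6, 9 * k + 7} : Set ℕ) with hG
  have hmem : ∀ g, g ∈ G ↔ ∃ n t, g = n * (3 * k + 2) + t ∧ (2 * n) % 3 ≤ t ∧ t ≤ n / 2 :=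
    fun g => f13_mem k g
  have hlarge : ∀ g, 2 * (3 * k + 2) * (3 * k + 2) + 2 ≤ g → g ∈ G :=
    fun g hg => (hmem g).2 (f13_large k g hg)
  have hinf : (Set.ofPred (fun x => x ∈ G ∧ 0 < x)).Infinite := by
    rw [Set.infinite_iff_exists_gt]
    intro a
    exact ⟨a + (2 * (3 * k + 2) * (3 * k + 2) + 2), ⟨hlarge _ (by omega), by omega⟩, by omega⟩
  have next : ∀ i y, posSeq G i < y → y ∈ G → (∀ g, posSeq G i < g → g ∈ G → y ≤ g) →
      posSeq G (i + 1) = y := fun i y a b c =>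
    f13_next _ hinf i y a ⟨b, by omega⟩ (fun g hg hP => c g hg hP.1)
  have p0 : posSeq G 0 = 6 * k + 5 := by
    have hm : (6 * k + 5) ∈ G ∧ 0 < 6 * k + 5 :=
      ⟨AddSubmonoid.subset_closure (by simp), by omega⟩
    apply le_antisymm
    · unfold posSeq; rw [Nat.nth_zero]; exact Nat.sInf_le hm
    · have h := Nat.nth_mem_of_infinite hinf 0
      have h1 := f13_gap k 0 _ (by simpa using h.2) ((hmem _).1 h.1)
      have h2 := f13_gap k 1 (posSeq G 0) (by unfold posSeq; omega) ((hmem _).1 h.1)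
      omega
  have p1 : posSeq G 1 = 9 * k + 6 := by
    apply next 0
    · omega
    · exact AddSubmonoid.subset_closure (by simp)
    · intro g hg hgG
      have := f13_gap k 2 g (by omega) ((hmem _).1 hgG)
      omega
  have p2 : posSeq G 2 = 9 * k + 7 := by
    apply next 1
    · omega
    · exact AddSubmonoid.subset_closure (by simp)
    · intro g hg hgG
      omega
  have inv : ∀ i, F13Inv k i (posSeq G i) := by
    intro i
    induction i with
    | zero => rw [p0]; exact Or.inr ⟨2, 1, by ring, by omega, by omega, by omega, by omega, by omega⟩
    | succ i ih =>
      obtain ⟨y, a, b, c, d, -⟩ := f13_step k i _ ih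
      rw [next i y a ((hmem y).2 b) (fun g hg hgG => c g hg ((hmem g).1 hgG))]
      exact d
  have step : ∀ i, i % 3 ≠ 2 → posSeq G (i + 1) % 3 = (posSeq G i + 1) % 3 := by
    intro i
    obtain ⟨y, a, b, c, -, d⟩ := f13_step k i _ (inv i)
    rw [next i y a ((hmem y).2 b) (fun g hg hgG => c g hg ((hmem g).1 hgG))]
    exact d
  refine ⟨?_, ?_, ?_⟩
  · apply (Set.finite_lt_nat (2 * (3 * k + 2) * (3 * k + 2) + 2)).subset
    intro g hg
    by_contra hc
    exact hg (hlarge g (by simpa using hc))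
  · have : posSeq G '' Set.Iio 3 = {6 * k + 5, 9 * k + 6, 9 * k + 7} := by
      ext x
      simp only [Set.mem_image, Set.mem_Iio, Set.mem_insert_iff, Set.mem_singleton_iff]
      constructor
      · rintro ⟨i, hi, rfl⟩
        interval_cases i <;> omega
      · rintro (rfl | rfl | rfl)
        · exact ⟨0, by omega, p0⟩
        · exact ⟨1, by omega, p1⟩
        · exact ⟨2, by omega, p2⟩
    rw [this]
  · intro m
    rw [Fintype.bijective_iff_injective_and_card]
    refine ⟨?_, by simp⟩
    have s0 := step (m * 3) (by omega)
    have s1 : posSeq G (m * 3 + 2) % 3 = (posSeq G (m * 3 + 1) + 1) % 3 := step (m * 3 + 1) (by omega)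
    intro a b hab
    have hab' := (ZMod.natCast_eq_natCast_iff' _ _ _).1 hab
    fin_cases a <;> fin_cases b <;> simp at hab' ⊢ <;> omega
end

section
/- For every positive integer k, the numerical semigroup generated by S = {12k+8, 12k+10, 18k+15} is a 3-permutation numerical semigroup. -/
namespace F15

/-- Membership of `n*s - b` (with `b < n`) in the semigroup. -/
def mem (n s b : ℕ) : Prop :=
  (b % 2 = 0 ∧ b ≤ s ∧ b + 1 ≠ s) ∨ (b % 2 = 1 ∧ b + n ≤ s + 1 ∧ b + n ≠ s)

def memS (n s b : ℕ) : Prop :=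
  (0 < b ∧ mem n s (b - 1)) ∨ (b = 0 ∧ mem n (s + 1) (n - 1))

def memP (n s b : ℕ) : Prop :=
  (b + 1 < n ∧ mem n s (b + 1)) ∨ (b + 1 = n ∧ mem n (s - 1) 0)

/-- constant for the runs -/
def cc (n s c : ℕ) : Prop :=
  ((s % 3 = 2 ∨ 2 * n ≤ s + 2) ∧ c = 1) ∨ (¬ (s % 3 = 2 ∨ 2 * n ≤ s + 2) ∧ c = 2)

/-- position mod 3 of the element `n*s - b`. -/
def pos (n s b p : ℕ) : Prop :=
  p < 3 ∧
  ((memS n s b ∧ ∃ c, cc n s c ∧ (p + s + b) % 3 = c % 3) ∨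
   (¬ memS n s b ∧ memP n s b ∧
      ∃ c, cc n (if b + 1 < n then s else s - 1) c ∧ (p + s + b) % 3 = c % 3) ∨
   (¬ memS n s b ∧ ¬ memP n s b ∧ 
      (((s + b % 2) % 3 = 1 ∧ (p + 2 * s + 2 * b) % 3 = 1) ∨ 
       ((s + b % 2) % 3 ≠ 1 ∧ (p + 2 * s + 2 * b) % 3 = 2))))

def nextRel (n s b s' b' : ℕ) : Prop :=
  (memS n s b ∧ ((0 < b ∧ s' = s ∧ b' + 1 = b) ∨ (b = 0 ∧ s' = s + 1 ∧ b' + 1 = n))) ∨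
  (¬ memS n s b ∧ ((2 ≤ b ∧ s' = s ∧ b' + 2 = b) ∨
    (b = 0 ∧ s % 2 = 1 ∧ s' = s + 1 ∧ b' = s + 1) ∨
    (b = 0 ∧ s % 2 = 0 ∧ s' = s + 1 ∧ b' + 2 = s)))

lemma next_exists (n k s b : ℕ) (hn : n = 6 * k + 5) (hs : 2 ≤ s) (hb : b < n)
    (h : mem n s b) : ∃ s' b', nextRel n s b s' b' := by
  by_cases hS : memS n s b
  · rcases Nat.eq_zero_or_pos b with h0 | h0
    · exact ⟨s + 1, n - 1, Or.inl ⟨hS, by omega⟩⟩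
    · exact ⟨s, b - 1, Or.inl ⟨hS, by omega⟩⟩
  · rcases Nat.lt_or_ge b 2 with h2 | h2
    · have : b = 0 := by
        unfold memS mem at hS
        by_contra hne
        have : b = 1 := by omega
        subst this
        omega
      rcases Nat.mod_two_eq_zero_or_one s with h3 | h3
      · exact ⟨s + 1, s - 2, Or.inr ⟨hS, by omega⟩⟩
      · exact ⟨s + 1, s + 1, Or.inr ⟨hS, by omega⟩⟩
    · exact ⟨s, b - 2, Or.inr ⟨hS, by omega⟩⟩

lemma next_mem (n k s b s' b' : ℕ) (hn : n = 6 * k + 5) (hs : 2 ≤ s) (hb : b < n)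
    (h : mem n s b) (hx : nextRel n s b s' b') : mem n s' b' ∧ b' < n ∧ 2 ≤ s' := by
  unfold nextRel memS at hx
  unfold mem at *
  rcases hx with ⟨hS, ⟨h1, rfl, h2⟩ | ⟨rfl, rfl, h2⟩⟩ |
    ⟨hS, ⟨h1, rfl, h2⟩ | ⟨rfl, h1, rfl, h2⟩ | ⟨rfl, h1, rfl, h2⟩⟩ <;> omega

lemma next_gap (n k s b s' b' : ℕ) (hn : n = 6 * k + 5) (hs : 2 ≤ s) (hb : b < n)
    (h : mem n s b) (hx : nextRel n s b s' b') : 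
    (s' = s ∧ b' < b ∧ ∀ c, b' < c → c < b → ¬ mem n s c) ∨
    (s' = s + 1 ∧ b = 0 ∧ ∀ c, b' < c → c < n → ¬ mem n (s + 1) c) := by
  unfold nextRel memS at hx
  unfold mem at *
  rcases hx with ⟨hS, ⟨h1, rfl, h2⟩ | ⟨rfl, rfl, h2⟩⟩ |
    ⟨hS, ⟨h1, rfl, h2⟩ | ⟨rfl, h1, rfl, h2⟩ | ⟨rfl, h1, rfl, h2⟩⟩
  · left; refine ⟨rfl, by omega, fun c _ _ => by omega⟩
  · right; refine ⟨rfl, rfl, fun c _ _ => by omega⟩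
  · left; refine ⟨rfl, by omega, fun c _ _ => ?_⟩
    have : c = b - 1 := by omega
    subst this; omega
  · right; refine ⟨rfl, rfl, fun c _ _ => by omega⟩
  · right; refine ⟨rfl, rfl, fun c _ _ => by omega⟩

lemma pos_exists (n s b : ℕ) : ∃ p, pos n s b p := by
  have hc : ∀ t, ∃ c, cc n t c := by
    intro t
    by_cases h : (t % 3 = 2 ∨ 2 * n ≤ t + 2)
    · exact ⟨1, Or.inl ⟨h, rfl⟩⟩
    · exact ⟨2, Or.inr ⟨h, rfl⟩⟩
  by_cases hS : memS n s b
  · obtain ⟨c, hc⟩ := hc s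
    exact ⟨(c + 2 * s + 2 * b) % 3, by omega, Or.inl ⟨hS, c, hc, by omega⟩⟩
  · by_cases hP : memP n s b
    · obtain ⟨c, hc⟩ := hc (if b + 1 < n then s else s - 1)
      exact ⟨(c + 2 * s + 2 * b) % 3, by omega, Or.inr (Or.inl ⟨hS, hP, c, hc, by omega⟩)⟩
    · by_cases h1 : (s + b % 2) % 3 = 1
      · exact ⟨(1 + s + b) % 3, by omega, Or.inr (Or.inr ⟨hS, hP, Or.inl ⟨h1, by omega⟩⟩)⟩
      · exact ⟨(2 + s + b) % 3, by omega, Or.inr (Or.inr ⟨hS, hP, Or.inr ⟨h1, by omega⟩⟩)⟩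

lemma memS_iff (n k s b : ℕ) (hn : n = 6 * k + 5) (hs : 2 ≤ s) (hb : b < n)
    (h : mem n s b) : memS n s b ↔ (b % 2 = 1 ∨ (b + n ≤ s + 2 ∧ b + n ≠ s + 1)) := by
  unfold memS mem at *
  omega

lemma memP_iff (n k s b : ℕ) (hn : n = 6 * k + 5) (hs : 3 ≤ s) (hb : b < n)
    (h : mem n s b) : memP n s b ↔ (b % 2 = 1 ∨ b + 1 = n ∨ (b + n ≤ s ∧ b + n + 1 ≠ s)) := by
  unfold memP mem at *
  omega

lemma pos_simp (n k s b p : ℕ) (hn : n = 6 * k + 5) (hs : 2 ≤ s) (hb : b < n)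
    (h : mem n s b) (hp : pos n s b p) :
    (b % 2 = 1 ∧ b + n ≤ s + 1 ∧ ∃ c, cc n s c ∧ (p + s + b) % 3 = c % 3) ∨
    (b % 2 = 0 ∧ b + n ≤ s + 2 ∧ b + n ≠ s + 1 ∧ ∃ c, cc n s c ∧ (p + s + b) % 3 = c % 3) ∨
    (b % 2 = 0 ∧ b + 1 = n ∧ b ≤ s ∧ s ≤ b + n ∧ ∃ c, cc n (s - 1) c ∧ (p + s + b) % 3 = c % 3) ∨
    (b % 2 = 0 ∧ b + 1 < n ∧ b ≤ s ∧ s < b + n ∧ b + 1 ≠ s ∧ b + n ≠ s + 2 ∧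
      ((s % 3 = 1 ∧ (p + 2 * s + 2 * b) % 3 = 1) ∨
       (s % 3 ≠ 1 ∧ (p + 2 * s + 2 * b) % 3 = 2))) := by
  obtain ⟨hp3, hp⟩ := hp
  rw [memS_iff n k s b hn hs hb h] at hp
  have hm := h
  unfold mem at hm
  have hP : memP n s b ↔ (b % 2 = 1 ∨ b + 1 = n ∨ (b + n ≤ s ∧ b + n + 1 ≠ s)) := by
    rcases Nat.lt_or_ge 2 s with h3 | h3
    · exact memP_iff n k s b hn h3 hb h
    · have : s = 2 := by omega
      subst this
      unfold memP mem
      omega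
  rw [hP] at hp
  rcases hp with ⟨hS1, hc⟩ | ⟨hS1, hP1, hc⟩ | ⟨hS1, hP1, h5⟩
  · rcases Nat.mod_two_eq_zero_or_one b with h2 | h2
    · right; left
      exact ⟨h2, by omega, by omega, hc⟩
    · left
      exact ⟨h2, by omega, hc⟩
  · right; right; left
    have h3 : b + 1 = n := by omega
    rw [if_neg (by omega)] at hc
    exact ⟨by omega, h3, by omega, by omega, hc⟩
  · right; right; right
    exact ⟨by omega, by omega, by omega, by omega, by omega, by omega, by omega⟩

lemma next_simp (n k s b s' b' : ℕ) (hn : n = 6 * k + 5) (hs : 2 ≤ s) (hb : b < n)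
    (h : mem n s b) (hx : nextRel n s b s' b') :
    (b % 2 = 1 ∧ s' = s ∧ b' + 1 = b) ∨
    (b % 2 = 0 ∧ b + n ≤ s + 2 ∧ b + n ≠ s + 1 ∧ 0 < b ∧ s' = s ∧ b' + 1 = b) ∨
    (b = 0 ∧ n ≤ s + 2 ∧ n ≠ s + 1 ∧ s' = s + 1 ∧ b' + 1 = n) ∨
    (b % 2 = 0 ∧ (s + 2 < b + n ∨ b + n = s + 1) ∧ 2 ≤ b ∧ s' = s ∧ b' + 2 = b) ∨
    (b = 0 ∧ s + 2 < n ∧ s % 2 = 1 ∧ s' = s + 1 ∧ b' = s + 1) ∨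
    (b = 0 ∧ (s + 2 < n ∨ n = s + 1) ∧ s % 2 = 0 ∧ s' = s + 1 ∧ b' + 2 = s) := by
  unfold nextRel at hx
  rw [memS_iff n k s b hn hs hb h] at hx
  rcases hx with ⟨hS, ⟨h1, h3, h2⟩ | ⟨h1, h3, h2⟩⟩ |
    ⟨hS, ⟨h1, h3, h2⟩ | ⟨h1, h3, h4, h2⟩ | ⟨h1, h3, h4, h2⟩⟩
  · rcases Nat.mod_two_eq_zero_or_one b with h4 | h4
    · exact Or.inr (Or.inl ⟨h4, by omega, by omega, h1, h3, h2⟩)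
    · exact Or.inl ⟨h4, h3, h2⟩
  · exact Or.inr (Or.inr (Or.inl ⟨h1, by omega, by omega, h3, h2⟩))
  · exact Or.inr (Or.inr (Or.inr (Or.inl ⟨by omega, by omega, h1, h3, h2⟩)))
  · exact Or.inr (Or.inr (Or.inr (Or.inr (Or.inl ⟨h1, by omega, h3, h4, h2⟩))))
  · exact Or.inr (Or.inr (Or.inr (Or.inr (Or.inr ⟨h1, by omega, h3, h4, h2⟩))))

set_option maxHeartbeats 4000000 in
lemma next_pos (n k s b s' b' p p' : ℕ) (hn : n = 6 * k + 5) (hs : 2 ≤ s) (hb : b < n)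
    (h : mem n s b) (hx : nextRel n s b s' b') (hp : pos n s b p) (hp' : pos n s' b' p') :
    p' % 3 = (p + 1) % 3 := by
  obtain ⟨hm', hb', hs'⟩ := next_mem n k s b s' b' hn hs hb h hx
  replace hp := pos_simp n k s b p hn hs hb h hp
  replace hp' := pos_simp n k s' b' p' hn hs' hb' hm' hp'
  replace hx := next_simp n k s b s' b' hn hs hb h hx
  clear h hm'
  rcases hx with ⟨x1, x2, x3⟩ | ⟨x1, x2, x3, x4, x5, x6⟩ | ⟨x1, x2, x3, x4, x5⟩ |
    ⟨x1, x2, x3, x4, x5⟩ | ⟨x1, x2, x3, x4, x5⟩ | ⟨x1, x2, x3, x4, x5⟩ <;>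
  subst s' <;>
  rcases hp with ⟨p1, p2, c, hc, p3⟩ | ⟨p1, p2, p3, c, hc, p4⟩ | ⟨p1, p2, p3, p5, c, hc, p4⟩ |
    ⟨p1, p2, p3, p4, p5, p6, ⟨p7, p8⟩ | ⟨p7, p8⟩⟩ <;>
  try (exfalso; omega; done)
  all_goals
  rcases hp' with ⟨q1, q2, c', hc', q3⟩ | ⟨q1, q2, q3, c', hc', q4⟩ | ⟨q1, q2, q3, q5, c', hc', q4⟩ |
    ⟨q1, q2, q3, q4, q5, q6, ⟨q7, q8⟩ | ⟨q7, q8⟩⟩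
  all_goals
  try (exfalso; omega; done)
  all_goals
  try simp only [cc] at hc
  all_goals
  try simp only [cc] at hc'
  all_goals
  try omega

lemma lemB (n k s b s' b' : ℕ) (hn : n = 6 * k + 5) (hs : 2 ≤ s) (hb : b < n)
    (h : mem n s b) (hx : nextRel n s b s' b') (hp : pos n s b 0) (hS : memS n s b) :
    memS n s' b' := by
  obtain ⟨hp3, hp⟩ := hp
  rcases hx with ⟨hS', ⟨h1, rfl, h2⟩ | ⟨rfl, rfl, h2⟩⟩ | ⟨hS', _⟩
  · rcases hp with ⟨hS1, c, hc, h5⟩ | ⟨hS1, hP1, c, hc, h5⟩ | ⟨hS1, hP1, h5⟩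
    · unfold memS cc mem at *; omega
    · exact absurd hS hS1
    · exact absurd hS hS1
  · rcases hp with ⟨hS1, c, hc, h5⟩ | ⟨hS1, hP1, c, hc, h5⟩ | ⟨hS1, hP1, h5⟩
    · unfold memS cc mem at *; omega
    · exact absurd hS hS1
    · exact absurd hS hS1
  · exact absurd hS hS'

lemma lemC (n k s b : ℕ) (hn : n = 6 * k + 5) (hs : 2 ≤ s) (hb : b < n)
    (h : mem n s b) (hp : pos n s b 1) (hS : ¬ memP n s b) :
    ¬ memS n s b := by
  obtain ⟨hp3, hp⟩ := hp
  rcases hp with ⟨hS1, c, hc, h5⟩ | ⟨hS1, hP1, c, hc, h5⟩ | ⟨hS1, hP1, h5⟩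
  · exfalso
    unfold memS memP cc mem at *; omega
  · exact hS1
  · exact hS1

lemma lemD (n k s b s' b' : ℕ) (hn : n = 6 * k + 5) (hs : 2 ≤ s) (hb : b < n)
    (h : mem n s b) (hx : nextRel n s b s' b') (hS : ¬ memS n s b) :
    ¬ memP n s' b' := by
  rcases hx with ⟨hS', _⟩ |
    ⟨hS', ⟨h1, rfl, h2⟩ | ⟨rfl, h1, rfl, h2⟩ | ⟨rfl, h1, rfl, h2⟩⟩
  · exact absurd hS' hS
  all_goals unfold memS memP mem at *; omega

lemma lemE (n k s b s' b' p : ℕ) (hn : n = 6 * k + 5) (hs : 2 ≤ s) (hb : b < n)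
    (h : mem n s b) (hx : nextRel n s b s' b') (hp : pos n s b p) (hp2 : p ≠ 2) (hS : ¬ memS n s b) :
    (2 * s' + b + s) % 3 = (2 + b' + 3 * s) % 3  := by
  obtain ⟨hp3, hp⟩ := hp
  rcases hx with ⟨hS', _⟩ |
    ⟨hS', ⟨h1, rfl, h2⟩ | ⟨rfl, h1, rfl, h2⟩ | ⟨rfl, h1, rfl, h2⟩⟩
  · exact absurd hS' hS
  · omega
  all_goals
    rcases hp with ⟨hS1, c, hc, h5⟩ | ⟨hS1, hP1, c, hc, h5⟩ | ⟨hS1, hP1, h5⟩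
    · exact absurd hS1 hS
    · unfold memS memP cc mem at *; omega
    · unfold memS memP mem at *; omega
end F15
namespace F15

/-- Explicit description of the semigroup. -/
def T (n x : ℕ) : Prop := ∃ s a, x + 2 * a = n * s ∧ 2 * a ≤ s ∧ 2 * a + 1 ≠ s

lemma mem_closure_iff (n k x : ℕ) (hn : n = 6 * k + 5) :
    x ∈ AddSubmonoid.closure ({12 * k + 8, 12 * k + 10, 18 * k + 15} : Set ℕ) ↔ T n x := by
  constructor
  · intro h
    induction h using AddSubmonoid.closure_induction with
    | mem y hy =>
      simp only [Set.mem_insert_iff, Set.mem_singleton_iff] at hy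
      rcases hy with rfl | rfl | rfl
      · exact ⟨2, 1, by omega, by omega, by omega⟩
      · exact ⟨2, 0, by omega, by omega, by omega⟩
      · exact ⟨3, 0, by omega, by omega, by omega⟩
    | zero => exact ⟨0, 0, by omega, by omega, by omega⟩
    | add y z _ _ hy hz =>
      obtain ⟨s, a, h1, h2, h3⟩ := hy
      obtain ⟨s', a', h1', h2', h3'⟩ := hz
      refine ⟨s + s', a + a', ?_, by omega, by omega⟩
      rw [Nat.mul_add n]; omega
  · rintro ⟨s, a, h1, h2, h3⟩
    have g1 : 12 * k + 8 ∈ AddSubmonoid.closure ({12 * k + 8, 12 * k + 10, 18 * k + 15} : Set ℕ) :=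
      AddSubmonoid.subset_closure (by simp)
    have g2 : 12 * k + 10 ∈ AddSubmonoid.closure ({12 * k + 8, 12 * k + 10, 18 * k + 15} : Set ℕ) :=
      AddSubmonoid.subset_closure (by simp)
    have g3 : 18 * k + 15 ∈ AddSubmonoid.closure ({12 * k + 8, 12 * k + 10, 18 * k + 15} : Set ℕ) :=
      AddSubmonoid.subset_closure (by simp)
    obtain ⟨t, rfl⟩ := Nat.exists_eq_add_of_le h2
    have key : ∃ u v, t = 2 * u + 3 * v := by
      rcases Nat.mod_two_eq_zero_or_one t with h | h
      · exact ⟨t / 2, 0, by omega⟩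
      · exact ⟨(t - 3) / 2, 1, by omega⟩
    obtain ⟨u, v, rfl⟩ := key
    have : x = a • (12 * k + 8) + u • (12 * k + 10) + v • (18 * k + 15) := by
      simp only [smul_eq_mul]
      subst hn
      have : x + 2 * a = (a * (12 * k + 8) + u * (12 * k + 10) + v * (18 * k + 15)) + 2 * a := by
        rw [h1]; ring
      omega
    rw [this]
    exact add_mem (add_mem (nsmul_mem g1 a) (nsmul_mem g2 u)) (nsmul_mem g3 v)

lemma T_iff (n k x s b : ℕ) (hn : n = 6 * k + 5) (hx : x + b = n * s) (hb : b < n) :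
    T n x ↔ mem n s b := by
  constructor
  · rintro ⟨s', a, h1, h2, h3⟩
    have hle : s ≤ s' := by
      by_contra hlt
      have : n * (s' + 1) ≤ n * s := Nat.mul_le_mul_left n (by omega)
      rw [Nat.mul_add] at this
      omega
    obtain ⟨d, rfl⟩ := Nat.exists_eq_add_of_le hle
    rw [Nat.mul_add] at h1
    have h4 : 2 * a = b + n * d := by omega
    rcases Nat.lt_or_ge d 2 with hd | hd
    · unfold mem
      have : d = 0 ∨ d = 1 := by omega
      rcases this with rfl | rfl <;> omega
    · obtain ⟨e, rfl⟩ := Nat.exists_eq_add_of_le hd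
      have h5 : n * (2 + e) = 6 * (k * (2 + e)) + 5 * (2 + e) := by rw [hn]; ring
      have h6 : n * (2 + e) = n + n + n * e := by ring
      have h7 : e ≤ n * e := Nat.le_mul_of_pos_left e (by omega)
      unfold mem
      omega
  · rintro (⟨h1, h2, h3⟩ | ⟨h1, h2, h3⟩)
    · exact ⟨s, b / 2, by omega, by omega, by omega⟩
    · refine ⟨s + 1, (b + n) / 2, ?_, by omega, by omega⟩
      rw [Nat.mul_add n]; omega

lemma rep_exists (n x : ℕ) (hn : 0 < n) : ∃ s b, x + b = n * s ∧ b < n := by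
  have h1 := Nat.div_add_mod x n
  have h2 := Nat.mod_lt x hn
  rcases Nat.eq_zero_or_pos (x % n) with h | h
  · exact ⟨x / n, 0, by omega, hn⟩
  · exact ⟨x / n + 1, n - x % n, by rw [Nat.mul_add]; omega, by omega⟩

/-- no elements strictly between -/
lemma gap (n k s b s' b' x y z : ℕ) (hn : n = 6 * k + 5) (hs : 2 ≤ s) (hb : b < n)
    (h : mem n s b) (hx : nextRel n s b s' b') (e : x + b = n * s) (e' : y + b' = n * s')
    (hb' : b' < n) : x < y ∧ (x < z → z < y → ¬ T n z) := by
  rcases next_gap n k s b s' b' hn hs hb h hx with ⟨rfl, h1, h2⟩ | ⟨rfl, rfl, h2⟩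
  · refine ⟨by omega, fun l1 l2 => ?_⟩
    rw [T_iff n k z s' (b - (z - x)) hn (by omega) (by omega)]
    exact h2 _ (by omega) (by omega)
  · rw [Nat.mul_add] at e'
    refine ⟨by omega, fun l1 l2 => ?_⟩
    rw [T_iff n k z (s + 1) (n - (z - x)) hn (by rw [Nat.mul_add]; omega) (by omega)]
    exact h2 _ (by omega) (by omega)

lemma count_next (p : ℕ → Prop) [DecidablePred p] (x y : ℕ) (hxy : x < y) (hx : p x)
    (h : ∀ z, x < z → z < y → ¬ p z) : Nat.count p y = Nat.count p x + 1 := by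
  obtain ⟨d, rfl⟩ := Nat.exists_eq_add_of_le (Nat.succ_le_of_lt hxy)
  induction d with
  | zero => simp [Nat.count_succ, hx]
  | succ d ih =>
    rw [← Nat.add_assoc, Nat.count_succ, if_neg (h _ (by omega) (by omega)), ih (by omega)
      (fun z h1 h2 => h z h1 (by omega))]

/-- A full state: `x` is an element with coordinates and the given index. -/
def St (n : ℕ) (P : ℕ → Prop) (i x s b p : ℕ) : Prop :=
  x + b = n * s ∧ b < n ∧ 2 ≤ s ∧ mem n s b ∧ pos n s b p ∧ Nat.nth P i = x ∧ 
    ∃ _ : DecidablePred P, Nat.count P x = i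

lemma step (n k i x s b p : ℕ) (hn : n = 6 * k + 5) (P : ℕ → Prop)
    (hP : ∀ z, P z ↔ (T n z ∧ 0 < z)) (h : St n P i x s b p) :
    ∃ y s' b' p', St n P (i + 1) y s' b' p' ∧ p' % 3 = (p + 1) % 3 ∧ nextRel n s b s' b' := by
  obtain ⟨e, hb, hs, hm, hp, hnth, hD, hc⟩ := h
  obtain ⟨s', b', hx⟩ := next_exists n k s b hn hs hb hm
  obtain ⟨hm', hb', hs'⟩ := next_mem n k s b s' b' hn hs hb hm hx
  obtain ⟨p', hp'⟩ := pos_exists n s' b'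
  have hle : n ≤ n * s' := Nat.le_mul_of_pos_right n (by omega)
  have hle2 : n ≤ n * s := Nat.le_mul_of_pos_right n (by omega)
  have e' : (n * s' - b') + b' = n * s' := by omega
  have hPx : P x := (hP x).2 ⟨(T_iff n k x s b hn e hb).2 hm, by omega⟩
  have hPy : P (n * s' - b') := (hP _).2 ⟨(T_iff n k _ s' b' hn e' hb').2 hm', by omega⟩
  have hcy : Nat.count P (n * s' - b') = i + 1 := by
    rw [← hc]
    refine count_next P x _ (gap n k s b s' b' x _ 0 hn hs hb hm hx e e' hb').1 hPx ?_
    intro z h1 h2 h3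
    exact (gap n k s b s' b' x _ z hn hs hb hm hx e e' hb').2 h1 h2 ((hP z).1 h3).1
  refine ⟨n * s' - b', s', b', p', ⟨e', hb', hs', hm', hp', ?_, hD, hcy⟩,
    next_pos n k s b s' b' p p' hn hs hb hm hx hp hp', hx⟩
  rw [← hcy]
  exact Nat.nth_count hPy

lemma next_succ (n s b s' b' x y : ℕ) (hx : nextRel n s b s' b') (hS : memS n s b)
    (e : x + b = n * s) (e' : y + b' = n * s') : y = x + 1 := by
  rcases hx with ⟨_, ⟨h1, rfl, h2⟩ | ⟨rfl, rfl, h2⟩⟩ | ⟨hS', _⟩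
  · omega
  · rw [Nat.mul_add] at e'; omega
  · exact absurd hS hS'

lemma res (n k s b x : ℕ) (hn : n = 6 * k + 5) (e : x + b = n * s) : (x + b) % 3 = (2 * s) % 3 := by
  have : n * s = 3 * ((2 * k + 1) * s) + 2 * s := by rw [hn]; ring
  omega

lemma triple (n k i x s b : ℕ) (hn : n = 6 * k + 5) (P : ℕ → Prop)
    (hP : ∀ z, P z ↔ (T n z ∧ 0 < z)) (h : St n P i x s b 0) :
    (Nat.nth P i % 3 ≠ Nat.nth P (i + 1) % 3 ∧ Nat.nth P i % 3 ≠ Nat.nth P (i + 2) % 3 ∧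
     Nat.nth P (i + 1) % 3 ≠ Nat.nth P (i + 2) % 3) ∧ ∃ y s' b', St n P (i + 3) y s' b' 0 := by
  obtain ⟨x1, s1, b1, p1, h1, hp1, hx1⟩ := step n k i x s b 0 hn P hP h
  obtain ⟨x2, s2, b2, p2, h2, hp2, hx2⟩ := step n k _ x1 s1 b1 p1 hn P hP h1
  obtain ⟨x3, s3, b3, p3, h3, hp3, hx3⟩ := step n k _ x2 s2 b2 p2 hn P hP h2
  have hp1' : p1 = 1 := by have := h1.2.2.2.2.1.1; omega
  have hp2' : p2 = 2 := by have := h2.2.2.2.2.1.1; omega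
  have hp3' : p3 = 0 := by have := h3.2.2.2.2.1.1; omega
  subst hp1' hp2' hp3'
  refine ⟨?_, x3, s3, b3, h3⟩
  obtain ⟨e, hb, hs, hm, hp, hnth, -⟩ := h
  obtain ⟨e1, hb1, hs1, hm1, hp1, hnth1, -⟩ := h1
  obtain ⟨e2, hb2, hs2, hm2, hp2, hnth2, -⟩ := h2
  have hnth2' : Nat.nth P (i + 2) = x2 := hnth2
  rw [hnth, hnth1, hnth2']
  by_cases hS : memS n s b
  · have hS1 := lemB n k s b s1 b1 hn hs hb hm hx1 hp hS
    have a1 := next_succ n s b s1 b1 x x1 hx1 hS e e1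
    have a2 := next_succ n s1 b1 s2 b2 x1 x2 hx2 hS1 e1 e2
    omega
  · have hP1 := lemD n k s b s1 b1 hn hs hb hm hx1 hS
    have hS1 := lemC n k s1 b1 hn hs1 hb1 hm1 hp1 hP1
    have a1 := lemE n k s b s1 b1 0 hn hs hb hm hx1 hp (by omega) hS
    have a2 := lemE n k s1 b1 s2 b2 1 hn hs1 hb1 hm1 hx2 hp1 (by omega) hS1
    have r := res n k s b x hn e
    have r1 := res n k s1 b1 x1 hn e1
    have r2 := res n k s2 b2 x2 hn e2
    omega

lemma first_state (n k : ℕ) (hk : 0 < k) (hn : n = 6 * k + 5) (P : ℕ → Prop)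
    (hP : ∀ z, P z ↔ (T n z ∧ 0 < z)) : St n P 0 (12 * k + 8) 2 2 0 := by
  classical
  have hm : mem n 2 2 := by unfold mem; omega
  have e : 12 * k + 8 + 2 = n * 2 := by omega
  have hPx : P (12 * k + 8) := (hP _).2 ⟨(T_iff n k _ 2 2 hn e (by omega)).2 hm, by omega⟩
  have hc : Nat.count P (12 * k + 8) = 0 := by
    rw [Nat.count_iff_forall_not]
    intro z hz hPz
    obtain ⟨hT, h0⟩ := (hP z).1 hPz
    obtain ⟨s, b, e, hb⟩ := rep_exists n z (by omega)
    rw [T_iff n k z s b hn e hb] at hT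
    have hs3 : s < 3 := by
      by_contra h
      have := Nat.mul_le_mul_left n (show 3 ≤ s by omega)
      omega
    unfold mem at hT
    interval_cases s <;> omega
  refine ⟨e, by omega, le_refl _, hm, ⟨by omega, Or.inr (Or.inr ⟨?_, ?_, by omega⟩)⟩, ?_, _, hc⟩
  · unfold memS mem; omega
  · unfold memP mem; omega
  · have := Nat.nth_count hPx
    rwa [hc] at this

lemma first_three (n k : ℕ) (hk : 0 < k) (hn : n = 6 * k + 5) (P : ℕ → Prop)
    (hP : ∀ z, P z ↔ (T n z ∧ 0 < z)) :
    Nat.nth P 0 = 12 * k + 8 ∧ Nat.nth P 1 = 12 * k + 10 ∧ Nat.nth P 2 = 18 * k + 15 := by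
  have h0 := first_state n k hk hn P hP
  obtain ⟨x1, s1, b1, p1, h1, -, hx1⟩ := step n k 0 _ 2 2 0 hn P hP h0
  have a1 : s1 = 2 ∧ b1 = 0 := by
    unfold nextRel memS mem at hx1; omega
  obtain ⟨rfl, rfl⟩ := a1
  obtain ⟨x2, s2, b2, p2, h2, -, hx2⟩ := step n k _ x1 2 0 p1 hn P hP h1
  have a2 : s2 = 3 ∧ b2 = 0 := by
    unfold nextRel memS mem at hx2; omega
  obtain ⟨rfl, rfl⟩ := a2
  refine ⟨h0.2.2.2.2.2.1, ?_, ?_⟩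
  · have := h1.2.2.2.2.2.1
    have := h1.1
    simp only [Nat.zero_add] at *
    omega
  · have := h2.2.2.2.2.2.1
    have := h2.1
    simp only [Nat.zero_add, Nat.reduceAdd] at *
    omega

lemma starts (n k : ℕ) (hk : 0 < k) (hn : n = 6 * k + 5) (P : ℕ → Prop)
    (hP : ∀ z, P z ↔ (T n z ∧ 0 < z)) (i : ℕ) : ∃ x s b, St n P (i * 3) x s b 0 := by
  induction i with
  | zero => exact ⟨_, _, _, by simpa using first_state n k hk hn P hP⟩
  | succ i ih =>
    obtain ⟨x, s, b, h⟩ := ih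
    have := (triple n k _ x s b hn P hP h).2
    rwa [Nat.succ_mul]

end F15

theorem family15_is_three_permutation (k : ℕ) (hk : 0 < k) :
    IsPermutationSemigroup 3 (AddSubmonoid.closure ({12 * k + 8, 12 * k + 10, 18 * k + 15} : Set ℕ)) := by
  obtain ⟨n, hn⟩ : ∃ n, n = 6 * k + 5 := ⟨_, rfl⟩
  have hG := fun x => F15.mem_closure_iff n k x hn
  generalize hGe : AddSubmonoid.closure ({12 * k + 8, 12 * k + 10, 18 * k + 15} : Set ℕ) = G at hG ⊢
  have hP : ∀ z, (z ∈ G ∧ 0 < z) ↔ (F15.T n z ∧ 0 < z) := fun z => by rw [hG]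
  refine ⟨?_, ?_, ?_⟩
  · refine (Set.finite_Iio (n * (2 * n + 2))).subset ?_
    intro x hx
    rw [Set.mem_Iio]
    by_contra hlt
    apply hx
    obtain ⟨s, b, e, hb⟩ := F15.rep_exists n x (by omega)
    rw [SetLike.mem_coe, hG, F15.T_iff n k x s b hn e hb]
    have hs : 2 * n + 2 ≤ s := Nat.le_of_mul_le_mul_left (show n * (2 * n + 2) ≤ n * s by omega) (by omega)
    unfold F15.mem
    omega
  · obtain ⟨h0, h1, h2⟩ := F15.first_three n k hk hn _ hP
    have : posSeq G '' Set.Iio 3 = {12 * k + 8, 12 * k + 10, 18 * k + 15} := by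
      have h3 : (Set.Iio 3 : Set ℕ) = {0, 1, 2} := by
        ext z; simp only [Set.mem_Iio, Set.mem_insert_iff, Set.mem_singleton_iff]; omega
      rw [h3, Set.image_insert_eq, Set.image_insert_eq, Set.image_singleton]
      unfold posSeq
      rw [h0, h1, h2]
    rw [this, hGe]
  · intro i
    obtain ⟨x, s, b, h⟩ := F15.starts n k hk hn _ hP i
    obtain ⟨⟨h1, h2, h3⟩, -⟩ := F15.triple n k _ x s b hn _ hP h
    rw [Fintype.bijective_iff_injective_and_card]
    refine ⟨?_, by simp⟩
    intro a c hac
    simp only [ZMod.natCast_eq_natCast_iff'] at hac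
    unfold posSeq at hac
    fin_cases a <;> fin_cases c <;> simp only [Nat.add_zero] at hac <;>
      first
      | rfl
      | exact absurd hac h1
      | exact absurd hac h2
      | exact absurd hac h3
      | exact absurd hac.symm h1
      | exact absurd hac.symm h2
      | exact absurd hac.symm h3
end
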